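/- For all x ∈ ℝ_{>0}^{10} and all c, d ∈ ℝ_{>0}: e_0^c(e_4^d(x)) = e_4^d(e_0^c(x)); i.e., the 0-action and the 4-action of the C_4^{(1)}-geometric crystal commute. -/

import Mathlib

namespace Stmt12

noncomputable section

/-! Coordinates: `x = (x44, x33, x43, x22, x32, x42, x11, x21, x31, x41)`
at indices `0, …, 9`. -/

def c4 (x : Fin 10 → ℝ) : ℝ :=
  x 9 * x 5 ^ 2 * x 2 ^ 2 * x 0 + x 1 ^ 2 * x 2 * x 5 ^ 2 * x 9 +
    x 1 ^ 2 * x 4 ^ 2 * x 5 * x 9 + x 1 ^ 2 * x 4 ^ 2 * x 8 ^ 2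
def c41 (c : ℝ) (x : Fin 10 → ℝ) : ℝ :=
  c * (x 9 * x 5 ^ 2 * x 2 ^ 2 * x 0) + x 1 ^ 2 * x 2 * x 5 ^ 2 * x 9 +
    x 1 ^ 2 * x 4 ^ 2 * x 5 * x 9 + x 1 ^ 2 * x 4 ^ 2 * x 8 ^ 2
def c42 (c : ℝ) (x : Fin 10 → ℝ) : ℝ :=
  c * (x 9 * x 5 ^ 2 * x 2 ^ 2 * x 0) + c * (x 1 ^ 2 * x 2 * x 5 ^ 2 * x 9) +
    x 1 ^ 2 * x 4 ^ 2 * x 5 * x 9 + x 1 ^ 2 * x 4 ^ 2 * x 8 ^ 2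
def c43 (c : ℝ) (x : Fin 10 → ℝ) : ℝ :=
  c * (x 9 * x 5 ^ 2 * x 2 ^ 2 * x 0) + c * (x 1 ^ 2 * x 2 * x 5 ^ 2 * x 9) +
    c * (x 1 ^ 2 * x 4 ^ 2 * x 5 * x 9) + x 1 ^ 2 * x 4 ^ 2 * x 8 ^ 2

def e4 (c : ℝ) (x : Fin 10 → ℝ) : Fin 10 → ℝ :=
  ![(c41 c x / c4 x) * x 0, x 1, (c42 c x / c41 c x) * x 2, x 3, x 4,
    (c43 c x / c42 c x) * x 5, x 6, x 7, x 8, (c * c4 x / c43 c x) * x 9]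

def c4p (x : Fin 10 → ℝ) : ℝ :=
  x 9 + (x 6 * x 5 / x 3 + x 7 * x 5 / x 4 + x 8) ^ 2 / x 5 +
    (x 7 + x 6 * x 2 / x 1 + x 6 * x 4 / x 3) ^ 2 / x 2 + x 6 ^ 2 / x 0
def c41p (c : ℝ) (x : Fin 10 → ℝ) : ℝ :=
  c * x 9 + (x 6 * x 5 / x 3 + x 7 * x 5 / x 4 + x 8) ^ 2 / x 5 +
    (x 7 + x 6 * x 2 / x 1 + x 6 * x 4 / x 3) ^ 2 / x 2 + x 6 ^ 2 / x 0
def c42p (c : ℝ) (x : Fin 10 → ℝ) : ℝ :=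
  c * x 9 + c * ((x 6 * x 5 / x 3 + x 7 * x 5 / x 4 + x 8) ^ 2 / x 5) +
    (x 7 + x 6 * x 2 / x 1 + x 6 * x 4 / x 3) ^ 2 / x 2 + x 6 ^ 2 / x 0
def c43p (c : ℝ) (x : Fin 10 → ℝ) : ℝ :=
  c * x 9 + c * ((x 6 * x 5 / x 3 + x 7 * x 5 / x 4 + x 8) ^ 2 / x 5) +
    c * ((x 7 + x 6 * x 2 / x 1 + x 6 * x 4 / x 3) ^ 2 / x 2) + x 6 ^ 2 / x 0

def pA (c : ℝ) (x : Fin 10 → ℝ) : ℝ :=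
  x 6 * x 3 * x 2 * c42p c x + c43p c x * (x 7 * x 3 * x 1) + c43p c x * (x 6 * x 4 * x 1)
def pB (x : Fin 10 → ℝ) : ℝ :=
  x 6 * x 3 * x 2 + x 7 * x 3 * x 1 + x 6 * x 4 * x 1
def pC (c : ℝ) (x : Fin 10 → ℝ) : ℝ :=
  c41p c x * (x 6 * x 4 * x 5) + c41p c x * (x 7 * x 3 * x 5) + c42p c x * (x 3 * x 8 * x 4)
def pD (x : Fin 10 → ℝ) : ℝ :=
  x 6 * x 4 * x 5 + x 7 * x 3 * x 5 + x 3 * x 8 * x 4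
def pG (c : ℝ) (x : Fin 10 → ℝ) : ℝ :=
  c41p c x * (x 6 ^ 2 * x 3 * x 4 * x 5 * x 2 + x 6 ^ 2 * x 4 ^ 2 * x 1 * x 5 +
      x 6 * x 7 * x 3 * x 4 * x 1 * x 5) +
    c42p c x * (x 6 * x 7 * x 3 ^ 2 * x 5 * x 2 + x 6 * x 3 ^ 2 * x 8 * x 4 * x 2 +
      x 6 * x 3 * x 8 * x 4 ^ 2 * x 1) +
    c43p c x * (x 6 * x 7 * x 3 * x 4 * x 1 * x 5 + x 7 ^ 2 * x 3 ^ 2 * x 1 * x 5 +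
      x 7 * x 3 ^ 2 * x 8 * x 4 * x 1)

def e0 (c : ℝ) (x : Fin 10 → ℝ) : Fin 10 → ℝ :=
  ![x 0 * c43p c x / (c * c4p x),
    x 1 * pA c x / (c * c4p x * pB x),
    x 2 * c42p c x / c43p c x,
    x 3 * pG c x / (pB x * pD x * c * c4p x),
    x 4 * pC c x * pB x / (pA c x * pD x),
    c41p c x * x 5 / c42p c x,
    x 6 / c,
    x 7 * c4p x * pD x * pB x / pG c x,
    x 8 * c4p x * pD x / pC c x,
    x 9 * c4p x / c41p c x]


/-! Outline of the argument.

Write `S` for `c4p`, with `S1, S2, S3` its variants, and `k = x11/x22 + x21/x32`.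

* Expanding the squares shows that `S` is a polynomial in `k`, the coordinates fixed by the
  action of index four, and the three sums `x41 + x31²/x42`, `x42 + x32²/x43`, `x43 + x33²/x44`.
  Each sum is preserved by that action, hence so is `S`.
* The polynomials `A`, `C`, `G` are divisible by `B`, `D`, `BD` respectively; the quotients
  (called `tA`, `tC`, `tG` below) again only involve preserved quantities. This settles the
  coordinates x33, x22, x32, x11, x21, x31.
* For the other four coordinates one computes how the summands of `c4` are rescaled by the action
  of index zero. Two quadratic relations (`key2`, `key3`) then telescope and give
  `c4 (e0 c x) = c4 x * S1 / (c² S)`.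
* From this, the ratios `c41/c4`, `c42/c4`, `c43/c4` transform exactly inversely to
  `S3, S2, S1` (lemmas `eq3`, `eq2`, `eq1`), which finishes the proof.
-/

def kk (x : Fin 10 → ℝ) : ℝ := x 6 / x 3 + x 7 / x 4

/-- The three quantities invariant under the `4`-action. -/
def i1 (x : Fin 10 → ℝ) : ℝ := x 9 + x 8 ^ 2 / x 5
def i2 (x : Fin 10 → ℝ) : ℝ := x 5 + x 4 ^ 2 / x 2
def i3 (x : Fin 10 → ℝ) : ℝ := x 2 + x 1 ^ 2 / x 0

def tA (c : ℝ) (x : Fin 10 → ℝ) : ℝ :=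
  c * c4p x - (c - 1) * (x 6 ^ 2 / x 1 ^ 2 * i3 x + x 6 * x 4 * kk x / x 1)
def tC (c : ℝ) (x : Fin 10 → ℝ) : ℝ :=
  c4p x + (c - 1) * (i1 x + kk x * x 8)
def tG (c : ℝ) (x : Fin 10 → ℝ) : ℝ :=
  c4p x + (c - 1) * (i1 x + kk x * x 8 + x 7 * x 8 / x 4 + x 7 * x 6 / x 1
    + kk x * x 7 / x 4 * i2 x)

lemma c4p_eq (x : Fin 10 → ℝ) (hx : ∀ i, 0 < x i) :
    c4p x = i1 x + kk x ^ 2 * i2 x + x 6 ^ 2 / x 1 ^ 2 * i3 x + 2 * kk x * x 8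
      + 2 * x 4 * kk x * x 6 / x 1 := by
  have h0 := hx 0; have h1 := hx 1; have h2 := hx 2; have h3 := hx 3; have h4 := hx 4
  have h5 := hx 5
  unfold c4p i1 i2 i3 kk
  field_simp
  ring

lemma c41p_eq (c : ℝ) (x : Fin 10 → ℝ) : c41p c x = c4p x + (c - 1) * x 9 := by
  unfold c41p c4p; ring

lemma c43p_eq (c : ℝ) (x : Fin 10 → ℝ) : c43p c x = c * c4p x - (c - 1) * (x 6 ^ 2 / x 0) := by
  unfold c43p c4p; ring

lemma c42p_eq1 (c : ℝ) (x : Fin 10 → ℝ) (hx : ∀ i, 0 < x i) :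
    c42p c x = c41p c x + (c - 1) * ((kk x * x 5 + x 8) ^ 2 / x 5) := by
  have h3 := hx 3; have h4 := hx 4; have h5 := hx 5
  unfold c42p c41p kk; ring

lemma c42p_eq3 (c : ℝ) (x : Fin 10 → ℝ) (hx : ∀ i, 0 < x i) :
    c42p c x = c43p c x - (c - 1) * ((x 4 * kk x + x 6 / x 1 * x 2) ^ 2 / x 2) := by
  have h4 := hx 4
  have : x 4 * kk x + x 6 / x 1 * x 2 = x 7 + x 6 * x 2 / x 1 + x 6 * x 4 / x 3 := by
    unfold kk; field_simp; ring
  rw [this]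
  unfold c42p c43p; ring

lemma tA_eq (c : ℝ) (x : Fin 10 → ℝ) (hx : ∀ i, 0 < x i) :
    tA c x = c43p c x - (c - 1) * (x 6 / x 1 * (x 4 * kk x + x 6 / x 1 * x 2)) := by
  have h0 := hx 0; have h1 := hx 1
  rw [c43p_eq]; unfold tA i3
  field_simp
  ring

lemma tC_eq (c : ℝ) (x : Fin 10 → ℝ) (hx : ∀ i, 0 < x i) :
    tC c x = c41p c x + (c - 1) * ((kk x * x 5 + x 8) * x 8 / x 5) := by
  have h5 := hx 5
  rw [c41p_eq]; unfold tC i1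
  field_simp
  ring

lemma pB_eq (x : Fin 10 → ℝ) (hx : ∀ i, 0 < x i) :
    pB x = x 3 * x 1 * (x 4 * kk x + x 6 / x 1 * x 2) := by
  have h1 := hx 1; have h3 := hx 3; have h4 := hx 4
  unfold pB kk; field_simp; ring

lemma pD_eq (x : Fin 10 → ℝ) (hx : ∀ i, 0 < x i) :
    pD x = x 3 * x 4 * (kk x * x 5 + x 8) := by
  have h3 := hx 3; have h4 := hx 4
  unfold pD kk; field_simp

lemma pA_eq (c : ℝ) (x : Fin 10 → ℝ) (hx : ∀ i, 0 < x i) : pA c x = pB x * tA c x := by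
  have h1 := hx 1; have h2 := hx 2; have h3 := hx 3; have h4 := hx 4
  rw [tA_eq c x hx]
  unfold pA; rw [c42p_eq3 c x hx]
  generalize c43p c x = S
  unfold pB kk
  field_simp
  ring

lemma pC_eq (c : ℝ) (x : Fin 10 → ℝ) (hx : ∀ i, 0 < x i) : pC c x = pD x * tC c x := by
  have h5 := hx 5; have h3 := hx 3; have h4 := hx 4
  rw [tC_eq c x hx]
  unfold pC; rw [c42p_eq1 c x hx]
  generalize c41p c x = S
  unfold pD kk
  field_simp
  ring

lemma tG_eq (c : ℝ) (x : Fin 10 → ℝ) (hx : ∀ i, 0 < x i) :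
    tG c x = c42p c x - (c - 1) * (x 6 / x 3 * (kk x * x 5 + x 8))
      + (c - 1) * (x 7 * (x 4 * kk x + x 6 / x 1 * x 2) / x 2) := by
  have h1 := hx 1; have h2 := hx 2; have h5 := hx 5; have h3 := hx 3; have h4 := hx 4
  rw [c42p_eq1 c x hx, c41p_eq]
  unfold tG i1 i2
  generalize c4p x = S
  unfold kk
  field_simp
  ring

lemma pG_eq (c : ℝ) (x : Fin 10 → ℝ) (hx : ∀ i, 0 < x i) :
    pG c x = pB x * pD x * tG c x := by
  have h1 := hx 1; have h2 := hx 2; have h5 := hx 5; have h3 := hx 3; have h4 := hx 4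
  have e1 : c41p c x = c42p c x - (c - 1) * ((kk x * x 5 + x 8) ^ 2 / x 5) := by
    rw [c42p_eq1 c x hx]; ring
  have e3 : c43p c x = c42p c x + (c - 1) * ((x 4 * kk x + x 6 / x 1 * x 2) ^ 2 / x 2) := by
    rw [c42p_eq3 c x hx]; ring
  rw [tG_eq c x hx]
  unfold pG; rw [e1, e3]
  generalize c42p c x = S
  unfold pB pD kk
  field_simp
  ring

lemma c4_pos (x : Fin 10 → ℝ) (hx : ∀ i, 0 < x i) : 0 < c4 x := by
  have h0 := hx 0; have h1 := hx 1; have h2 := hx 2; have h3 := hx 3; have h4 := hx 4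
  have h5 := hx 5; have h6 := hx 6; have h7 := hx 7; have h8 := hx 8; have h9 := hx 9
  unfold c4; positivity

lemma c41_pos (c : ℝ) (hc : 0 < c) (x : Fin 10 → ℝ) (hx : ∀ i, 0 < x i) : 0 < c41 c x := by
  have h0 := hx 0; have h1 := hx 1; have h2 := hx 2; have h3 := hx 3; have h4 := hx 4
  have h5 := hx 5; have h6 := hx 6; have h7 := hx 7; have h8 := hx 8; have h9 := hx 9
  unfold c41; positivity

lemma c42_pos (c : ℝ) (hc : 0 < c) (x : Fin 10 → ℝ) (hx : ∀ i, 0 < x i) : 0 < c42 c x := by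
  have h0 := hx 0; have h1 := hx 1; have h2 := hx 2; have h3 := hx 3; have h4 := hx 4
  have h5 := hx 5; have h6 := hx 6; have h7 := hx 7; have h8 := hx 8; have h9 := hx 9
  unfold c42; positivity

lemma c43_pos (c : ℝ) (hc : 0 < c) (x : Fin 10 → ℝ) (hx : ∀ i, 0 < x i) : 0 < c43 c x := by
  have h0 := hx 0; have h1 := hx 1; have h2 := hx 2; have h3 := hx 3; have h4 := hx 4
  have h5 := hx 5; have h6 := hx 6; have h7 := hx 7; have h8 := hx 8; have h9 := hx 9
  unfold c43; positivity

lemma c4p_pos (x : Fin 10 → ℝ) (hx : ∀ i, 0 < x i) : 0 < c4p x := by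
  have h0 := hx 0; have h1 := hx 1; have h2 := hx 2; have h3 := hx 3; have h4 := hx 4
  have h5 := hx 5; have h6 := hx 6; have h7 := hx 7; have h8 := hx 8; have h9 := hx 9
  unfold c4p; positivity

lemma c41p_pos (c : ℝ) (hc : 0 < c) (x : Fin 10 → ℝ) (hx : ∀ i, 0 < x i) : 0 < c41p c x := by
  have h0 := hx 0; have h1 := hx 1; have h2 := hx 2; have h3 := hx 3; have h4 := hx 4
  have h5 := hx 5; have h6 := hx 6; have h7 := hx 7; have h8 := hx 8; have h9 := hx 9
  unfold c41p; positivity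

lemma c42p_pos (c : ℝ) (hc : 0 < c) (x : Fin 10 → ℝ) (hx : ∀ i, 0 < x i) : 0 < c42p c x := by
  have h0 := hx 0; have h1 := hx 1; have h2 := hx 2; have h3 := hx 3; have h4 := hx 4
  have h5 := hx 5; have h6 := hx 6; have h7 := hx 7; have h8 := hx 8; have h9 := hx 9
  unfold c42p; positivity

lemma c43p_pos (c : ℝ) (hc : 0 < c) (x : Fin 10 → ℝ) (hx : ∀ i, 0 < x i) : 0 < c43p c x := by
  have h0 := hx 0; have h1 := hx 1; have h2 := hx 2; have h3 := hx 3; have h4 := hx 4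
  have h5 := hx 5; have h6 := hx 6; have h7 := hx 7; have h8 := hx 8; have h9 := hx 9
  unfold c43p; positivity

lemma pA_pos (c : ℝ) (hc : 0 < c) (x : Fin 10 → ℝ) (hx : ∀ i, 0 < x i) : 0 < pA c x := by
  have h0 := hx 0; have h1 := hx 1; have h2 := hx 2; have h3 := hx 3; have h4 := hx 4
  have h5 := hx 5; have h6 := hx 6; have h7 := hx 7; have h8 := hx 8; have h9 := hx 9
  have q1 := c41p_pos c hc x hx; have q2 := c42p_pos c hc x hx; have q3 := c43p_pos c hc x hx
  unfold pA; positivity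

lemma pB_pos (x : Fin 10 → ℝ) (hx : ∀ i, 0 < x i) : 0 < pB x := by
  have h0 := hx 0; have h1 := hx 1; have h2 := hx 2; have h3 := hx 3; have h4 := hx 4
  have h5 := hx 5; have h6 := hx 6; have h7 := hx 7; have h8 := hx 8; have h9 := hx 9
  unfold pB; positivity

lemma pC_pos (c : ℝ) (hc : 0 < c) (x : Fin 10 → ℝ) (hx : ∀ i, 0 < x i) : 0 < pC c x := by
  have h0 := hx 0; have h1 := hx 1; have h2 := hx 2; have h3 := hx 3; have h4 := hx 4
  have h5 := hx 5; have h6 := hx 6; have h7 := hx 7; have h8 := hx 8; have h9 := hx 9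
  have q1 := c41p_pos c hc x hx; have q2 := c42p_pos c hc x hx; have q3 := c43p_pos c hc x hx
  unfold pC; positivity

lemma pD_pos (x : Fin 10 → ℝ) (hx : ∀ i, 0 < x i) : 0 < pD x := by
  have h0 := hx 0; have h1 := hx 1; have h2 := hx 2; have h3 := hx 3; have h4 := hx 4
  have h5 := hx 5; have h6 := hx 6; have h7 := hx 7; have h8 := hx 8; have h9 := hx 9
  unfold pD; positivity

lemma pG_pos (c : ℝ) (hc : 0 < c) (x : Fin 10 → ℝ) (hx : ∀ i, 0 < x i) : 0 < pG c x := by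
  have h0 := hx 0; have h1 := hx 1; have h2 := hx 2; have h3 := hx 3; have h4 := hx 4
  have h5 := hx 5; have h6 := hx 6; have h7 := hx 7; have h8 := hx 8; have h9 := hx 9
  have q1 := c41p_pos c hc x hx; have q2 := c42p_pos c hc x hx; have q3 := c43p_pos c hc x hx
  unfold pG; positivity

lemma kk_pos (x : Fin 10 → ℝ) (hx : ∀ i, 0 < x i) : 0 < kk x := by
  have h3 := hx 3; have h4 := hx 4; have h6 := hx 6; have h7 := hx 7
  unfold kk; positivity

lemma tA_pos (c : ℝ) (hc : 0 < c) (x : Fin 10 → ℝ) (hx : ∀ i, 0 < x i) : 0 < tA c x := by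
  have h := pA_pos c hc x hx
  rw [pA_eq c x hx] at h
  exact pos_of_mul_pos_right h (pB_pos x hx).le

lemma tC_pos (c : ℝ) (hc : 0 < c) (x : Fin 10 → ℝ) (hx : ∀ i, 0 < x i) : 0 < tC c x := by
  have h := pC_pos c hc x hx
  rw [pC_eq c x hx] at h
  exact pos_of_mul_pos_right h (pD_pos x hx).le

lemma tG_pos (c : ℝ) (hc : 0 < c) (x : Fin 10 → ℝ) (hx : ∀ i, 0 < x i) : 0 < tG c x := by
  have h := pG_pos c hc x hx
  rw [pG_eq c x hx] at h
  exact pos_of_mul_pos_right h (mul_pos (pB_pos x hx) (pD_pos x hx)).le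

lemma e0_eq (c : ℝ) (hc : 0 < c) (x : Fin 10 → ℝ) (hx : ∀ i, 0 < x i) :
    e0 c x = ![x 0 * c43p c x / (c * c4p x), x 1 * tA c x / (c * c4p x),
      x 2 * c42p c x / c43p c x, x 3 * tG c x / (c * c4p x), x 4 * tC c x / tA c x,
      c41p c x * x 5 / c42p c x, x 6 / c, x 7 * c4p x / tG c x, x 8 * c4p x / tC c x,
      x 9 * c4p x / c41p c x] := by
  have b := pB_pos x hx
  have d := pD_pos x hx
  have a := tA_pos c hc x hx
  have g := tG_pos c hc x hx
  have e := tC_pos c hc x hx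
  have s := c4p_pos x hx
  unfold e0
  rw [pA_eq c x hx, pC_eq c x hx, pG_eq c x hx]
  congr 1
  congr 1
  · field_simp
  congr 1
  congr 1
  · field_simp
  congr 1
  · field_simp
  congr 1
  congr 1
  congr 1
  · field_simp
  congr 1
  field_simp

lemma e4_pos (d : ℝ) (hd : 0 < d) (x : Fin 10 → ℝ) (hx : ∀ i, 0 < x i) :
    ∀ i, 0 < e4 d x i := by
  have m0 := c4_pos x hx
  have m1 := c41_pos d hd x hx
  have m2 := c42_pos d hd x hx
  have m3 := c43_pos d hd x hx
  have h0 := hx 0; have h2 := hx 2; have h5 := hx 5; have h9 := hx 9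
  intro i
  fin_cases i
  · show 0 < (c41 d x / c4 x) * x 0
    positivity
  · exact hx 1
  · show 0 < (c42 d x / c41 d x) * x 2
    positivity
  · exact hx 3
  · exact hx 4
  · show 0 < (c43 d x / c42 d x) * x 5
    positivity
  · exact hx 6
  · exact hx 7
  · exact hx 8
  · show 0 < (d * c4 x / c43 d x) * x 9
    positivity

lemma i1_e4 (d : ℝ) (hd : 0 < d) (x : Fin 10 → ℝ) (hx : ∀ i, 0 < x i) :
    i1 (e4 d x) = i1 x := by
  have m2 := c42_pos d hd x hx
  have m3 := c43_pos d hd x hx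
  have h5 := hx 5
  show (d * c4 x / c43 d x) * x 9 + x 8 ^ 2 / ((c43 d x / c42 d x) * x 5) = x 9 + x 8 ^ 2 / x 5
  field_simp
  unfold c4 c42 c43
  ring

lemma i2_e4 (d : ℝ) (hd : 0 < d) (x : Fin 10 → ℝ) (hx : ∀ i, 0 < x i) :
    i2 (e4 d x) = i2 x := by
  have m1 := c41_pos d hd x hx
  have m2 := c42_pos d hd x hx
  have h2 := hx 2
  show (c43 d x / c42 d x) * x 5 + x 4 ^ 2 / ((c42 d x / c41 d x) * x 2) = x 5 + x 4 ^ 2 / x 2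
  field_simp
  unfold c41 c42 c43
  ring

lemma i3_e4 (d : ℝ) (hd : 0 < d) (x : Fin 10 → ℝ) (hx : ∀ i, 0 < x i) :
    i3 (e4 d x) = i3 x := by
  have m0 := c4_pos x hx
  have m1 := c41_pos d hd x hx
  have h0 := hx 0
  show (c42 d x / c41 d x) * x 2 + x 1 ^ 2 / ((c41 d x / c4 x) * x 0) = x 2 + x 1 ^ 2 / x 0
  field_simp
  unfold c4 c41 c42
  ring

lemma kk_e4 (d : ℝ) (x : Fin 10 → ℝ) : kk (e4 d x) = kk x := rfl

lemma c4p_e4 (d : ℝ) (hd : 0 < d) (x : Fin 10 → ℝ) (hx : ∀ i, 0 < x i) :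
    c4p (e4 d x) = c4p x := by
  rw [c4p_eq _ (e4_pos d hd x hx), c4p_eq x hx, i1_e4 d hd x hx, i2_e4 d hd x hx,
    i3_e4 d hd x hx, kk_e4]
  rfl

lemma tA_e4 (c d : ℝ) (hd : 0 < d) (x : Fin 10 → ℝ) (hx : ∀ i, 0 < x i) :
    tA c (e4 d x) = tA c x := by
  unfold tA
  rw [c4p_e4 d hd x hx, i3_e4 d hd x hx, kk_e4]
  rfl

lemma tC_e4 (c d : ℝ) (hd : 0 < d) (x : Fin 10 → ℝ) (hx : ∀ i, 0 < x i) :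
    tC c (e4 d x) = tC c x := by
  unfold tC
  rw [c4p_e4 d hd x hx, i1_e4 d hd x hx, kk_e4]
  rfl

lemma tG_e4 (c d : ℝ) (hd : 0 < d) (x : Fin 10 → ℝ) (hx : ∀ i, 0 < x i) :
    tG c (e4 d x) = tG c x := by
  unfold tG
  rw [c4p_e4 d hd x hx, i1_e4 d hd x hx, i2_e4 d hd x hx, kk_e4]
  rfl

/-- The four summands of `c4`. -/
def n1 (x : Fin 10 → ℝ) : ℝ := x 9 * x 5 ^ 2 * x 2 ^ 2 * x 0
def n2 (x : Fin 10 → ℝ) : ℝ := x 1 ^ 2 * x 2 * x 5 ^ 2 * x 9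
def n3 (x : Fin 10 → ℝ) : ℝ := x 1 ^ 2 * x 4 ^ 2 * x 5 * x 9
def n4 (x : Fin 10 → ℝ) : ℝ := x 1 ^ 2 * x 4 ^ 2 * x 8 ^ 2

lemma key2 (c : ℝ) (x : Fin 10 → ℝ) (hx : ∀ i, 0 < x i) :
    c43p c x * c42p c x + (c - 1) * (x 4 ^ 2 * kk x ^ 2 / x 2) * c43p c x
      = c42p c x * ((c - 1) * (x 6 ^ 2 * x 2 / x 1 ^ 2)) + tA c x ^ 2 := by
  have h1 := hx 1; have h2 := hx 2
  rw [tA_eq c x hx, c42p_eq3 c x hx]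
  field_simp
  ring

lemma key3 (c : ℝ) (x : Fin 10 → ℝ) (hx : ∀ i, 0 < x i) :
    c41p c x * ((c - 1) * (kk x ^ 2 * x 5)) + tC c x ^ 2
      = c41p c x * c42p c x + (c - 1) * (x 8 ^ 2 / x 5) * c42p c x := by
  have h5 := hx 5
  rw [tC_eq c x hx, c42p_eq1 c x hx]
  field_simp
  ring

/-- `key2` multiplied by `n2`. -/
lemma key2' (c : ℝ) (x : Fin 10 → ℝ) (hx : ∀ i, 0 < x i) :
    c43p c x * (c42p c x * (n1 x + n2 x) + (c - 1) * (kk x ^ 2 * x 5) * n3 x)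
      = c * c4p x * c42p c x * n1 x + n2 x * tA c x ^ 2 := by
  have h0 := hx 0; have h1 := hx 1; have h2 := hx 2
  have k := key2 c x hx
  have e : tA c x ^ 2 = c43p c x * c42p c x + (c - 1) * (x 4 ^ 2 * kk x ^ 2 / x 2) * c43p c x
    - c42p c x * ((c - 1) * (x 6 ^ 2 * x 2 / x 1 ^ 2)) := by linarith
  have e2 : c * c4p x = c43p c x + (c - 1) * (x 6 ^ 2 / x 0) := by rw [c43p_eq]; ring
  rw [e, e2]
  unfold n1 n2 n3
  field_simp
  ring

lemma key3' (c : ℝ) (x : Fin 10 → ℝ) (hx : ∀ i, 0 < x i) :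
    c41p c x * ((c - 1) * (kk x ^ 2 * x 5)) * n3 x + n3 x * tC c x ^ 2
      + n4 x * c4p x * c42p c x = (n3 x + n4 x) * c41p c x * c42p c x := by
  have h5 := hx 5
  have k := key3 c x hx
  have e : tC c x ^ 2 = c41p c x * c42p c x + (c - 1) * (x 8 ^ 2 / x 5) * c42p c x
    - c41p c x * ((c - 1) * (kk x ^ 2 * x 5)) := by linarith
  have e2 : c4p x = c41p c x - (c - 1) * x 9 := by rw [c41p_eq]; ring
  rw [e, e2]
  unfold n3 n4
  field_simp
  ring

lemma c4_n (x : Fin 10 → ℝ) : c4 x = n1 x + n2 x + n3 x + n4 x := rfl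
lemma c41_n (d : ℝ) (x : Fin 10 → ℝ) : c41 d x = d * n1 x + n2 x + n3 x + n4 x := rfl
lemma c42_n (d : ℝ) (x : Fin 10 → ℝ) : c42 d x = d * n1 x + d * n2 x + n3 x + n4 x := rfl
lemma c43_n (d : ℝ) (x : Fin 10 → ℝ) : c43 d x = d * n1 x + d * n2 x + d * n3 x + n4 x := rfl

lemma n1_e0 (c : ℝ) (hc : 0 < c) (x : Fin 10 → ℝ) (hx : ∀ i, 0 < x i) :
    n1 (e0 c x) = n1 x * c41p c x / (c * c43p c x) := by
  have s0 := c4p_pos x hx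
  have s1 := c41p_pos c hc x hx
  have s2 := c42p_pos c hc x hx
  have s3 := c43p_pos c hc x hx
  rw [e0_eq c hc x hx]
  show (x 9 * c4p x / c41p c x) * (c41p c x * x 5 / c42p c x) ^ 2
    * (x 2 * c42p c x / c43p c x) ^ 2 * (x 0 * c43p c x / (c * c4p x)) = _
  unfold n1
  field_simp

lemma n2_e0 (c : ℝ) (hc : 0 < c) (x : Fin 10 → ℝ) (hx : ∀ i, 0 < x i) :
    n2 (e0 c x) = n2 x * tA c x ^ 2 * c41p c x / (c ^ 2 * c4p x * c43p c x * c42p c x) := by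
  have s0 := c4p_pos x hx
  have s1 := c41p_pos c hc x hx
  have s2 := c42p_pos c hc x hx
  have s3 := c43p_pos c hc x hx
  rw [e0_eq c hc x hx]
  show (x 1 * tA c x / (c * c4p x)) ^ 2 * (x 2 * c42p c x / c43p c x)
    * (c41p c x * x 5 / c42p c x) ^ 2 * (x 9 * c4p x / c41p c x) = _
  unfold n2
  field_simp

lemma n3_e0 (c : ℝ) (hc : 0 < c) (x : Fin 10 → ℝ) (hx : ∀ i, 0 < x i) :
    n3 (e0 c x) = n3 x * tC c x ^ 2 / (c ^ 2 * c4p x * c42p c x) := by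
  have s0 := c4p_pos x hx
  have s1 := c41p_pos c hc x hx
  have s2 := c42p_pos c hc x hx
  have a := tA_pos c hc x hx
  rw [e0_eq c hc x hx]
  show (x 1 * tA c x / (c * c4p x)) ^ 2 * (x 4 * tC c x / tA c x) ^ 2
    * (c41p c x * x 5 / c42p c x) * (x 9 * c4p x / c41p c x) = _
  unfold n3
  field_simp

lemma n4_e0 (c : ℝ) (hc : 0 < c) (x : Fin 10 → ℝ) (hx : ∀ i, 0 < x i) :
    n4 (e0 c x) = n4 x / c ^ 2 := by
  have s0 := c4p_pos x hx
  have a := tA_pos c hc x hx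
  have e := tC_pos c hc x hx
  rw [e0_eq c hc x hx]
  show (x 1 * tA c x / (c * c4p x)) ^ 2 * (x 4 * tC c x / tA c x) ^ 2
    * (x 8 * c4p x / tC c x) ^ 2 = _
  unfold n4
  field_simp

/-- Sum of the first two summands after the `0`-action. -/
lemma n12_e0 (c : ℝ) (hc : 0 < c) (x : Fin 10 → ℝ) (hx : ∀ i, 0 < x i) :
    n1 (e0 c x) + n2 (e0 c x) = c41p c x / (c ^ 2 * c4p x * c42p c x) *
      (c42p c x * (n1 x + n2 x) + (c - 1) * (kk x ^ 2 * x 5) * n3 x) := by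
  have s0 := c4p_pos x hx
  have s2 := c42p_pos c hc x hx
  have s3 := c43p_pos c hc x hx
  rw [n1_e0 c hc x hx, n2_e0 c hc x hx]
  have k := key2' c x hx
  field_simp
  linear_combination (-c41p c x) * k

/-- The key identity. -/
lemma c4_e0 (c : ℝ) (hc : 0 < c) (x : Fin 10 → ℝ) (hx : ∀ i, 0 < x i) :
    c4 (e0 c x) = c4 x * c41p c x / (c ^ 2 * c4p x) := by
  have s0 := c4p_pos x hx
  have s2 := c42p_pos c hc x hx
  rw [c4_n (e0 c x), n12_e0 c hc x hx, n3_e0 c hc x hx, n4_e0 c hc x hx, c4_n]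
  have k := key3' c x hx
  field_simp
  linear_combination k

lemma eq3 (c d : ℝ) (hc : 0 < c) (hd : 0 < d) (x : Fin 10 → ℝ) (hx : ∀ i, 0 < x i) :
    c43p c (e4 d x) * (c41 d x / c4 x) = c43p c x * (c41 d (e0 c x) / c4 (e0 c x)) := by
  have s0 := c4p_pos x hx
  have s1 := c41p_pos c hc x hx
  have s3 := c43p_pos c hc x hx
  have m0 := c4_pos x hx
  have m1 := c41_pos d hd x hx
  have h0 := hx 0
  have e : c41 d (e0 c x) = c4 (e0 c x) + (d - 1) * n1 (e0 c x) := by rw [c41_n, c4_n]; ring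
  have e' : c41 d x = c4 x + (d - 1) * n1 x := by rw [c41_n, c4_n]; ring
  rw [e, c4_e0 c hc x hx, n1_e0 c hc x hx, c43p_eq c (e4 d x), c4p_e4 d hd x hx]
  show (c * c4p x - (c - 1) * (x 6 ^ 2 / ((c41 d x / c4 x) * x 0))) * (c41 d x / c4 x) = _
  have l : (c * c4p x - (c - 1) * (x 6 ^ 2 / ((c41 d x / c4 x) * x 0))) * (c41 d x / c4 x)
      = c * c4p x * c41 d x / c4 x - (c - 1) * (x 6 ^ 2 / x 0) := by
    field_simp
  have l2 : (c - 1) * (x 6 ^ 2 / x 0) = c * c4p x - c43p c x := by rw [c43p_eq]; ring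
  rw [l, l2, e']
  field_simp
  ring

lemma eq2 (c d : ℝ) (hc : 0 < c) (hd : 0 < d) (x : Fin 10 → ℝ) (hx : ∀ i, 0 < x i) :
    c42p c (e4 d x) * (c42 d x / c4 x) = c42p c x * (c42 d (e0 c x) / c4 (e0 c x)) := by
  have s0 := c4p_pos x hx
  have s1 := c41p_pos c hc x hx
  have s2 := c42p_pos c hc x hx
  have m0 := c4_pos x hx
  have m1 := c41_pos d hd x hx
  have m2 := c42_pos d hd x hx
  have h2 := hx 2
  have h1 := hx 1
  have h0 := hx 0
  have q (y : Fin 10 → ℝ) (hy : ∀ i, 0 < y i) : c42p c y = c * c4p y - (c - 1) *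
      (y 4 ^ 2 * kk y ^ 2 / y 2 + 2 * y 4 * kk y * y 6 / y 1 + y 6 ^ 2 / y 1 ^ 2 * i3 y) := by
    have h2 := hy 2; have h1 := hy 1; have h0 := hy 0
    rw [c42p_eq3 c y hy, c43p_eq]
    unfold i3
    field_simp
    ring
  have e : c42 d (e0 c x) = c4 (e0 c x) + (d - 1) * (n1 (e0 c x) + n2 (e0 c x)) := by
    rw [c42_n, c4_n]; ring
  have e' : c42 d x = c4 x + (d - 1) * (n1 x + n2 x) := by rw [c42_n, c4_n]; ring
  have e'' : c41 d x = c42 d x - (d - 1) * n2 x := by rw [c42_n, c41_n]; ring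
  have w : c42p c (e4 d x) = c42p c x + (c - 1) * (x 4 ^ 2 * kk x ^ 2 / x 2)
      - (c - 1) * (x 4 ^ 2 * kk x ^ 2 / ((c42 d x / c41 d x) * x 2)) := by
    rw [q _ (e4_pos d hd x hx), q x hx, c4p_e4 d hd x hx, i3_e4 d hd x hx, kk_e4]
    show c * c4p x - (c - 1) * (x 4 ^ 2 * kk x ^ 2 / ((c42 d x / c41 d x) * x 2)
      + 2 * x 4 * kk x * x 6 / x 1 + x 6 ^ 2 / x 1 ^ 2 * i3 x) = _
    ring
  have w2 : c42p c (e4 d x) * (c42 d x / c4 x) = (c42p c x * c42 d x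
      + (c - 1) * (x 4 ^ 2 * kk x ^ 2 / x 2) * ((d - 1) * n2 x)) / c4 x := by
    have : (d - 1) * n2 x = c42 d x - c41 d x := by rw [e'']; ring
    rw [w, this]
    field_simp
    ring
  have w3 : (x 4 ^ 2 * kk x ^ 2 / x 2) * n2 x = kk x ^ 2 * x 5 * n3 x := by
    unfold n2 n3; field_simp
  have w4 : (c - 1) * (x 4 ^ 2 * kk x ^ 2 / x 2) * ((d - 1) * n2 x)
      = (c - 1) * (d - 1) * (kk x ^ 2 * x 5 * n3 x) := by rw [← w3]; ring
  rw [w2, w4, e, n12_e0 c hc x hx, c4_e0 c hc x hx, e']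
  field_simp
  ring

lemma eq1 (c d : ℝ) (hc : 0 < c) (hd : 0 < d) (x : Fin 10 → ℝ) (hx : ∀ i, 0 < x i) :
    c41p c (e4 d x) * (c43 d x / c4 x) = c41p c x * (c43 d (e0 c x) / c4 (e0 c x)) := by
  have s0 := c4p_pos x hx
  have s1 := c41p_pos c hc x hx
  have m0 := c4_pos x hx
  have m3 := c43_pos d hd x hx
  have e : c43 d (e0 c x) = d * c4 (e0 c x) - (d - 1) * n4 (e0 c x) := by rw [c43_n, c4_n]; ring
  have e' : c43 d x = d * c4 x - (d - 1) * n4 x := by rw [c43_n, c4_n]; ring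
  rw [e, c4_e0 c hc x hx, n4_e0 c hc x hx, c41p_eq c (e4 d x), c4p_e4 d hd x hx]
  show (c4p x + (c - 1) * ((d * c4 x / c43 d x) * x 9)) * (c43 d x / c4 x) = _
  have l : (c4p x + (c - 1) * ((d * c4 x / c43 d x) * x 9)) * (c43 d x / c4 x)
      = c4p x * c43 d x / c4 x + d * ((c - 1) * x 9) := by
    field_simp
  have l2 : (c - 1) * x 9 = c41p c x - c4p x := by rw [c41p_eq]; ring
  rw [l, l2, e']
  field_simp
  ring

lemma e0_pos (c : ℝ) (hc : 0 < c) (x : Fin 10 → ℝ) (hx : ∀ i, 0 < x i) :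
    ∀ i, 0 < e0 c x i := by
  have s0 := c4p_pos x hx
  have s1 := c41p_pos c hc x hx
  have s2 := c42p_pos c hc x hx
  have s3 := c43p_pos c hc x hx
  have a := tA_pos c hc x hx
  have g := tG_pos c hc x hx
  have e := tC_pos c hc x hx
  rw [e0_eq c hc x hx]
  intro i
  have h0 := hx 0; have h1 := hx 1; have h2 := hx 2; have h3 := hx 3; have h4 := hx 4
  have h5 := hx 5; have h6 := hx 6; have h7 := hx 7; have h8 := hx 8; have h9 := hx 9
  fin_cases i <;> simp <;> positivity

/-- The `0`-action and the `4`-action of the `C_4^{(1)}`-geometric crystal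
commute. -/
theorem e0_e4_commute (x : Fin 10 → ℝ) (hx : ∀ i, 0 < x i)
    (c d : ℝ) (hc : 0 < c) (hd : 0 < d) :
    e0 c (e4 d x) = e4 d (e0 c x) := by
  have hy := e4_pos d hd x hx
  have hz := e0_pos c hc x hx
  have s0 := c4p_pos x hx
  have s1 := c41p_pos c hc x hx
  have s2 := c42p_pos c hc x hx
  have s3 := c43p_pos c hc x hx
  have m0 := c4_pos x hx
  have m1 := c41_pos d hd x hx
  have m2 := c42_pos d hd x hx
  have m3 := c43_pos d hd x hx
  have t1 := c41p_pos c hc _ hy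
  have t2 := c42p_pos c hc _ hy
  have t3 := c43p_pos c hc _ hy
  have k0 := c4_pos _ hz
  have k1 := c41_pos d hd _ hz
  have k2 := c42_pos d hd _ hz
  have k3 := c43_pos d hd _ hz
  have E1 := eq1 c d hc hd x hx
  have E2 := eq2 c d hc hd x hx
  have E3 := eq3 c d hc hd x hx
  have F1 : c41p c (e4 d x) = c41p c x * (c43 d (e0 c x) / c4 (e0 c x)) * (c4 x / c43 d x) := by
    rw [← E1]; field_simp
  have F2 : c42p c (e4 d x) = c42p c x * (c42 d (e0 c x) / c4 (e0 c x)) * (c4 x / c42 d x) := by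
    rw [← E2]; field_simp
  have F3 : c43p c (e4 d x) = c43p c x * (c41 d (e0 c x) / c4 (e0 c x)) * (c4 x / c41 d x) := by
    rw [← E3]; field_simp
  rw [e0_eq c hc _ hy, c4p_e4 d hd x hx, tA_e4 c d hd x hx, tC_e4 c d hd x hx,
    tG_e4 c d hd x hx, F1, F2, F3]
  unfold e4
  have R := e0_eq c hc x hx
  generalize c41 d (e0 c x) = K1 at *
  generalize c42 d (e0 c x) = K2 at *
  generalize c43 d (e0 c x) = K3 at *
  generalize c4 (e0 c x) = K0 at *
  rw [R]
  ext i
  fin_cases i <;> simp <;> field_simp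

end

end Stmt12
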